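/- Unconditional functional moment inequality in dimension 1, j-th moment form: if φ, ψ: R → R ∪ {+∞} are even Borel functions with φ(x) + ψ(ξ) ≥ xξ for all x, ξ, then for each nonnegative integer j, (∫_R x^{2j} e^{−φ(x)} dx)(∫_R ξ^{2j} e^{−ψ(ξ)} dξ) ≤ 2π ((2j−1)!!)², with equality for φ(x) = x²/2, ψ(ξ) = ξ²/2. -/

import Mathlib

open scoped ENNReal

/-- The exponential of an extended real, valued in `ℝ≥0∞`, with `e^{-∞} = 0`, `e^{+∞} = ∞`. -/
noncomputable def expEReal (e : EReal) : ℝ≥0∞ :=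
  if e = ⊥ then 0 else if e = ⊤ then ⊤ else ENNReal.ofReal (Real.exp e.toReal)

open MeasureTheory Set

theorem expEReal_eq_exp (e : EReal) : expEReal e = EReal.exp e := by
  induction e <;> simp [expEReal]

/-- One-dimensional Brunn–Minkowski inequality for compact sets. -/
theorem volume_add_volume_le_of_isCompact {K L T : Set ℝ} (hK : IsCompact K) (hL : IsCompact L)
    (hK₀ : K.Nonempty) (hL₀ : L.Nonempty) (hT : ∀ a ∈ K, ∀ b ∈ L, a + b ∈ T) :
    volume K + volume L ≤ volume T := by
  obtain ⟨k, hkK, hk⟩ := hK.exists_isGreatest hK₀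
  obtain ⟨l, hlL, hl⟩ := hL.exists_isLeast hL₀
  have hK' : volume ((fun x => x + -l) ⁻¹' K) = volume K := measure_preimage_add_right _ _ _
  have hL' : volume ((fun x => -k + x) ⁻¹' L) = volume L := measure_preimage_add _ _ _
  have hd : AEDisjoint volume ((fun x => x + -l) ⁻¹' K) ((fun x => -k + x) ⁻¹' L) := by
    refine measure_mono_null (t := {k + l}) ?_ (by simp)
    rintro x ⟨hx, hx'⟩
    have h₁ := hk hx
    have h₂ := hl hx'
    simp only [mem_singleton_iff]
    linarith
  rw [← hK', ← hL',
    ← measure_union₀ (hL.measurableSet.preimage (by fun_prop)).nullMeasurableSet hd]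
  refine measure_mono (union_subset (fun x hx => ?_) fun x hx => ?_)
  · simpa using hT _ hx _ hlL
  · simpa using hT _ hkK _ hx

/-- One-dimensional Brunn–Minkowski inequality for midpoints of measurable sets. -/
theorem volume_add_volume_le_two_mul {A B S : Set ℝ} (hA : MeasurableSet A) (hB : MeasurableSet B)
    (hA₀ : A.Nonempty) (hB₀ : B.Nonempty) (hS : ∀ a ∈ A, ∀ b ∈ B, (a + b) / 2 ∈ S) :
    volume A + volume B ≤ 2 * volume S := by
  obtain ⟨a₀, ha₀⟩ := hA₀
  obtain ⟨b₀, hb₀⟩ := hB₀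
  have hT : 2 * volume S = volume ((fun x : ℝ => 2⁻¹ * x) ⁻¹' S) := by
    rw [Real.volume_preimage_mul_left (by norm_num)]
    simp
  have key : ∀ K, K ⊆ A ∧ IsCompact K → ∀ L, L ⊆ B ∧ IsCompact L →
      volume K + volume L ≤ 2 * volume S := by
    rintro K ⟨hKA, hK⟩ L ⟨hLB, hL⟩
    rw [hT]
    refine (add_le_add (measure_mono (subset_insert a₀ K))
      (measure_mono (subset_insert b₀ L))).trans
      (volume_add_volume_le_of_isCompact (hK.insert a₀) (hL.insert b₀) (insert_nonempty _ _)
        (insert_nonempty _ _) fun a ha b hb => ?_)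
    have := hS a (insert_subset ha₀ hKA ha) b (insert_subset hb₀ hLB hb)
    simpa [div_eq_inv_mul] using this
  rw [hA.measure_eq_iSup_isCompact, hB.measure_eq_iSup_isCompact]
  simp_rw [iSup_and']
  exact ENNReal.biSup_add_biSup_le' ⟨∅, by simp⟩ ⟨∅, by simp⟩ key

/-- Additive form of the Prékopa–Leindler inequality for functions with supremum `1`. -/
theorem lintegral_add_lintegral_le_of_sup_eq_one {f g h : ℝ → ℝ} (hf : Measurable f)
    (hg : Measurable g) (hh : Measurable h) (hf₀ : 0 ≤ f) (hg₀ : 0 ≤ g) (hh₀ : 0 ≤ h)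
    (hf₁ : ∀ u, f u ≤ 1) (hg₁ : ∀ v, g v ≤ 1)
    (hfs : ∀ t < 1, ∃ u, t < f u) (hgs : ∀ t < 1, ∃ v, t < g v)
    (H : ∀ u v, f u * g v ≤ h ((u + v) / 2) ^ 2) :
    (∫⁻ u, ENNReal.ofReal (f u)) + ∫⁻ v, ENNReal.ofReal (g v) ≤
      2 * ∫⁻ w, ENNReal.ofReal (h w) := by
  rw [lintegral_eq_lintegral_meas_lt _ (.of_forall hf₀) hf.aemeasurable,
    lintegral_eq_lintegral_meas_lt _ (.of_forall hg₀) hg.aemeasurable,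
    lintegral_eq_lintegral_meas_lt _ (.of_forall hh₀) hh.aemeasurable,
    ← lintegral_const_mul' _ _ (by simp)]
  refine (le_lintegral_add _ _).trans (setLIntegral_mono' measurableSet_Ioi fun t ht => ?_)
  rw [mem_Ioi] at ht
  rcases lt_or_ge t 1 with ht₁ | ht₁
  · refine volume_add_volume_le_two_mul (measurableSet_lt measurable_const hf)
      (measurableSet_lt measurable_const hg) (hfs t ht₁) (hgs t ht₁) fun a ha b hb => ?_
    refine lt_of_pow_lt_pow_left₀ 2 (hh₀ _) (lt_of_lt_of_le ?_ (H a b))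
    rw [sq]
    exact mul_lt_mul'' ha hb ht.le ht.le
  · simp [fun u => ((hf₁ u).trans ht₁).not_gt, fun u => ((hg₁ u).trans ht₁).not_gt]

theorem ENNReal.mul_le_sq_of_add_le_two_mul {a b c : ℝ≥0∞} (h : a + b ≤ 2 * c) : a * b ≤ c ^ 2 := by
  rcases eq_or_ne c ⊤ with rfl | hc
  · simp
  have hs : a + b ≠ ⊤ := ne_top_of_le_ne_top (ENNReal.mul_ne_top (by simp) hc) h
  obtain ⟨ha, hb⟩ := ENNReal.add_ne_top.1 hs
  lift a to NNReal using ha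
  lift b to NNReal using hb
  lift c to NNReal using hc
  norm_cast at h ⊢
  rw [← NNReal.coe_le_coe] at h ⊢
  push_cast at h ⊢
  nlinarith [sq_nonneg ((a : ℝ) - b), a.2, b.2, c.2, mul_self_le_mul_self (add_nonneg a.2 b.2) h]

theorem lintegral_mul_lintegral_le_sq_of_bddAbove {f g h : ℝ → ℝ} (hf : Measurable f)
    (hg : Measurable g) (hh : Measurable h) (hf₀ : 0 ≤ f) (hg₀ : 0 ≤ g) (hh₀ : 0 ≤ h)
    (hfb : BddAbove (range f)) (hgb : BddAbove (range g))
    (H : ∀ u v, f u * g v ≤ h ((u + v) / 2) ^ 2) :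
    (∫⁻ u, ENNReal.ofReal (f u)) * ∫⁻ v, ENNReal.ofReal (g v) ≤
      (∫⁻ w, ENNReal.ofReal (h w)) ^ 2 := by
  have normalized : ∀ {p : ℝ → ℝ}, BddAbove (range p) → 0 < ⨆ u, p u →
      (∀ u, p u / (⨆ u, p u) ≤ 1) ∧ ∀ t < 1, ∃ u, t < p u / (⨆ u, p u) := by
    intro p hp hpos
    refine ⟨fun u => (div_le_one hpos).2 (le_ciSup hp u), fun t ht => ?_⟩
    obtain ⟨u, hu⟩ := exists_lt_of_lt_ciSup (mul_lt_of_lt_one_left hpos ht)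
    exact ⟨u, (lt_div_iff₀ hpos).2 hu⟩
  have trivial_case : ∀ {p : ℝ → ℝ}, BddAbove (range p) → ⨆ u, p u ≤ 0 →
      ∫⁻ u, ENNReal.ofReal (p u) = 0 := fun hp hle => by
    simp [fun u => ENNReal.ofReal_of_nonpos ((le_ciSup hp u).trans hle)]
  rcases le_or_gt (⨆ u, f u) 0 with ha | ha
  · simp [trivial_case hfb ha]
  rcases le_or_gt (⨆ v, g v) 0 with hb | hb
  · simp [trivial_case hgb hb]
  obtain ⟨hf₁, hfs⟩ := normalized hfb ha
  obtain ⟨hg₁, hgs⟩ := normalized hgb hb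
  set a := ⨆ u, f u
  set b := ⨆ v, g v
  set c := √(a * b)
  have hc : 0 < c := Real.sqrt_pos.2 (mul_pos ha hb)
  have hcsq : c ^ 2 = a * b := Real.sq_sqrt (mul_pos ha hb).le
  have key := ENNReal.mul_le_sq_of_add_le_two_mul <|
    lintegral_add_lintegral_le_of_sup_eq_one (hf.div_const a) (hg.div_const b) (hh.div_const c)
      (fun u => div_nonneg (hf₀ u) ha.le) (fun u => div_nonneg (hg₀ u) hb.le)
      (fun u => div_nonneg (hh₀ u) hc.le) hf₁ hg₁ hfs hgs fun u v => by
        rw [div_pow, hcsq, div_mul_div_comm]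
        exact div_le_div_of_nonneg_right (H u v) (mul_pos ha hb).le
  have scale : ∀ {r : ℝ}, 0 < r → ∀ p : ℝ → ℝ,
      ∫⁻ u, ENNReal.ofReal (p u) = ENNReal.ofReal r * ∫⁻ u, ENNReal.ofReal (p u / r) :=
    fun {r} hr p => by
      rw [← lintegral_const_mul' _ _ ENNReal.ofReal_ne_top]
      congr with u
      rw [← ENNReal.ofReal_mul hr.le, mul_div_cancel₀ _ hr.ne']
  rw [scale ha f, scale hb g, scale hc h, mul_pow, ← ENNReal.ofReal_pow hc.le, hcsq,
    ENNReal.ofReal_mul ha.le, mul_mul_mul_comm]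
  gcongr

/-- The one-dimensional Prékopa–Leindler inequality with exponent `1 / 2`. -/
theorem lintegral_mul_lintegral_le_sq {f g h : ℝ → ℝ} (hf : Measurable f)
    (hg : Measurable g) (hh : Measurable h) (hf₀ : 0 ≤ f) (hg₀ : 0 ≤ g) (hh₀ : 0 ≤ h)
    (H : ∀ u v, f u * g v ≤ h ((u + v) / 2) ^ 2) :
    (∫⁻ u, ENNReal.ofReal (f u)) * ∫⁻ v, ENNReal.ofReal (g v) ≤
      (∫⁻ w, ENNReal.ofReal (h w)) ^ 2 := by
  have mono : ∀ p : ℝ → ℝ, Monotone fun (n : ℕ) u => ENNReal.ofReal (min (p u) n) :=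
    fun p m n hmn u => by dsimp only; gcongr
  have approx : ∀ {p : ℝ → ℝ}, Measurable p →
      ∫⁻ u, ENNReal.ofReal (p u) = ⨆ n : ℕ, ∫⁻ u, ENNReal.ofReal (min (p u) n) := by
    intro p hp
    rw [← lintegral_iSup (fun n => by fun_prop) (mono p)]
    congr with u
    refine le_antisymm ?_ (iSup_le fun n => ENNReal.ofReal_le_ofReal (min_le_left _ _))
    obtain ⟨n, hn⟩ := exists_nat_ge (p u)
    exact le_iSup_of_le n (by rw [min_eq_left hn])
  have nonneg : ∀ {p : ℝ → ℝ}, 0 ≤ p → ∀ n : ℕ, 0 ≤ fun u => min (p u) n :=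
    fun hp n u => le_min (hp u) n.cast_nonneg
  rw [approx hf, approx hg, ENNReal.iSup_mul]
  refine iSup_le fun m => ?_
  rw [ENNReal.mul_iSup]
  refine iSup_le fun n => ?_
  refine lintegral_mul_lintegral_le_sq_of_bddAbove (by fun_prop) (by fun_prop) hh (nonneg hf₀ m)
    (nonneg hg₀ n) hh₀ ⟨m, ?_⟩ ⟨n, ?_⟩ fun u v => le_trans ?_ (H u v)
  · rintro _ ⟨u, rfl⟩
    exact min_le_right _ _
  · rintro _ ⟨u, rfl⟩
    exact min_le_right _ _
  · exact mul_le_mul (min_le_left _ _) (min_le_left _ _) (nonneg hg₀ n v) (hf₀ u)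

/-- The substitution `x = e^u` for the even moments of an even weight. -/
theorem lintegral_even_moment_eq {F : ℝ → ℝ≥0∞} (hF : ∀ x, F (-x) = F x) (j : ℕ) :
    ∫⁻ x : ℝ, ENNReal.ofReal (x ^ (2 * j)) * F x =
      2 * ∫⁻ u : ℝ, ENNReal.ofReal (Real.exp ((2 * j + 1) * u)) * F (Real.exp u) := by
  set G : ℝ → ℝ≥0∞ := fun x => ENNReal.ofReal (x ^ (2 * j)) * F x
  have hG : ∀ x, G (-x) = G x := fun x => by simp [G, hF, (even_two_mul j).neg_pow]
  have hneg : ∫⁻ x in Iic 0, G x = ∫⁻ x in Ioi 0, G x := by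
    rw [setLIntegral_congr Iio_ae_eq_Iic.symm,
      ← (Measure.measurePreserving_neg volume).setLIntegral_comp_preimage_emb
        (MeasurableEquiv.neg ℝ).measurableEmbedding G (Iio 0)]
    simp [hG]
  have hpos : ∫⁻ x in Ioi 0, G x =
      ∫⁻ u : ℝ, ENNReal.ofReal (Real.exp ((2 * j + 1) * u)) * F (Real.exp u) := by
    rw [← Real.range_exp, ← image_univ,
      lintegral_image_eq_lintegral_abs_deriv_mul MeasurableSet.univ
      (fun x _ => (Real.hasDerivAt_exp x).hasDerivWithinAt)
      Real.exp_injective.injOn, setLIntegral_univ]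
    congr with u
    rw [← mul_assoc, ← ENNReal.ofReal_mul (abs_nonneg _), Real.abs_exp, ← Real.exp_nat_mul,
      ← Real.exp_add]
    congr 3
    push_cast
    ring
  rw [← lintegral_add_compl G (measurableSet_Ioi (a := (0 : ℝ))), compl_Ioi, hneg, hpos,
    ← two_mul]

theorem lintegral_even_moment_gaussian (j : ℕ) :
    ∫⁻ x : ℝ, ENNReal.ofReal (x ^ (2 * j)) * ENNReal.ofReal (Real.exp (-(x ^ 2 / 2))) =
      ENNReal.ofReal (√(2 * Real.pi) * (Nat.doubleFactorial (2 * j - 1) : ℝ)) := by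
  have hfun : ∀ x : ℝ, x ^ (2 * j) * Real.exp (-(x ^ 2 / 2)) =
      x ^ ((2 * j : ℕ) : ℝ) * Real.exp (-(1 / 2) * x ^ 2) := fun x => by
    rw [Real.rpow_natCast]
    congr 2
    ring
  have hint : Integrable fun x : ℝ => x ^ (2 * j) * Real.exp (-(x ^ 2 / 2)) := by
    simp_rw [hfun]
    exact integrable_rpow_mul_exp_neg_mul_sq (by norm_num)
      (lt_of_lt_of_le (by norm_num) (Nat.cast_nonneg _))
  simp_rw [← ENNReal.ofReal_mul ((even_two_mul j).pow_nonneg _)]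
  rw [← ofReal_integral_eq_lintegral_ofReal hint
    (.of_forall fun x => mul_nonneg ((even_two_mul j).pow_nonneg _) (Real.exp_nonneg _))]
  congr 1
  have habs := integral_comp_abs (f := fun x : ℝ => x ^ (2 * j) * Real.exp (-(x ^ 2 / 2)))
  simp only [(even_two_mul j).pow_abs, sq_abs] at habs
  have hgamma := integral_rpow_mul_exp_neg_mul_rpow (p := 2) (q := (2 * j : ℕ)) (b := 1 / 2)
    (by norm_num) (lt_of_lt_of_le (by norm_num) (Nat.cast_nonneg _)) (by norm_num)
  simp_rw [Real.rpow_two] at hgamma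
  simp_rw [habs, hfun, hgamma]
  rw [show (((2 * j : ℕ) : ℝ) + 1) / 2 = j + 1 / 2 by push_cast; ring,
    show -(((2 * j : ℕ) : ℝ) + 1) / 2 = -(j + 1 / 2) by push_cast; ring, Real.Gamma_nat_add_half,
    one_div, Real.inv_rpow (by norm_num), Real.rpow_neg (by norm_num), inv_inv,
    Real.rpow_add (by norm_num), Real.rpow_natCast, ← one_div, ← Real.sqrt_eq_rpow,
    Real.sqrt_mul (by norm_num)]
  field_simp

/-- One-dimensional unconditional moment inequality: if `φ, ψ : ℝ → ℝ ∪ {+∞}` are even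
Borel functions with `φ(x) + ψ(ξ) ≥ xξ`, then for every `j ≥ 0`,
`(∫ x^{2j} e^{-φ(x)} dx)(∫ ξ^{2j} e^{-ψ(ξ)} dξ) ≤ 2π ((2j-1)!!)²`, with equality for
`φ(x) = x²/2`, `ψ(ξ) = ξ²/2`. -/
theorem moment_inequality_dim_one (φ ψ : ℝ → EReal)
    (hφm : Measurable φ) (hψm : Measurable ψ)
    (hφb : ∀ x, φ x ≠ ⊥) (hψb : ∀ ξ, ψ ξ ≠ ⊥)
    (hφe : ∀ x, φ (-x) = φ x) (hψe : ∀ ξ, ψ (-ξ) = ψ ξ)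
    (hdual : ∀ x ξ : ℝ, ((x * ξ : ℝ) : EReal) ≤ φ x + ψ ξ)
    (j : ℕ) :
    ((∫⁻ x : ℝ, ENNReal.ofReal (x ^ (2*j)) * expEReal (-(φ x))) *
        (∫⁻ ξ : ℝ, ENNReal.ofReal (ξ ^ (2*j)) * expEReal (-(ψ ξ))) ≤
      ENNReal.ofReal (2 * Real.pi * (Nat.doubleFactorial (2*j - 1) : ℝ)^2)) ∧
    ((∫⁻ x : ℝ, ENNReal.ofReal (x ^ (2*j)) * expEReal (((-(x^2/2) : ℝ) : EReal))) *
        (∫⁻ ξ : ℝ, ENNReal.ofReal (ξ ^ (2*j)) * expEReal (((-(ξ^2/2) : ℝ) : EReal))) =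
      ENNReal.ofReal (2 * Real.pi * (Nat.doubleFactorial (2*j - 1) : ℝ)^2)) := by
  have hconst : ENNReal.ofReal (2 * Real.pi * (Nat.doubleFactorial (2*j - 1) : ℝ)^2) =
      (∫⁻ x : ℝ, ENNReal.ofReal (x ^ (2 * j)) * ENNReal.ofReal (Real.exp (-(x ^ 2 / 2)))) ^ 2 := by
    rw [lintegral_even_moment_gaussian, ← ENNReal.ofReal_pow (by positivity), mul_pow,
      Real.sq_sqrt (by positivity)]
  simp_rw [expEReal_eq_exp, EReal.exp_coe]
  refine ⟨?_, by rw [hconst, sq]⟩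
  have weight : ∀ {χ : ℝ → EReal}, (∀ x, χ x ≠ ⊥) → (∀ x, χ (-x) = χ x) →
      ∫⁻ x : ℝ, ENNReal.ofReal (x ^ (2 * j)) * EReal.exp (-(χ x)) = 2 * ∫⁻ u : ℝ, ENNReal.ofReal
        (Real.exp ((2 * j + 1) * u) * (EReal.exp (-(χ (Real.exp u)))).toReal) := by
    intro χ hb he
    rw [lintegral_even_moment_eq (F := fun x => EReal.exp (-(χ x))) fun x => by simp only [he]]
    congr with u
    rw [ENNReal.ofReal_mul (Real.exp_nonneg _), ENNReal.ofReal_toReal (by simpa using hb _)]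
  rw [hconst, weight hφb hφe, weight hψb hψe,
    lintegral_even_moment_eq (F := fun x => ENNReal.ofReal (Real.exp (-(x ^ 2 / 2)))) (by simp),
    mul_mul_mul_comm, mul_pow, ← sq]
  simp_rw [← ENNReal.ofReal_mul (Real.exp_nonneg _)]
  gcongr
  refine lintegral_mul_lintegral_le_sq (by fun_prop) (by fun_prop) (by fun_prop)
    (fun u => by positivity) (fun u => by positivity) (fun u => by positivity) fun u v => ?_
  have hle : EReal.exp (-(φ (Real.exp u))) * EReal.exp (-(ψ (Real.exp v))) ≤
      ENNReal.ofReal (Real.exp (-Real.exp (u + v))) := by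
    rw [← EReal.exp_add, ← EReal.exp_coe, EReal.exp_le_exp_iff, ← sub_eq_add_neg,
      ← EReal.neg_add (.inl (hφb _)) (.inr (hψb _)), EReal.coe_neg, EReal.neg_le_neg_iff,
      Real.exp_add]
    exact hdual _ _
  have hle' := ENNReal.toReal_mono ENNReal.ofReal_ne_top hle
  rw [ENNReal.toReal_mul, ENNReal.toReal_ofReal (Real.exp_nonneg _)] at hle'
  rw [mul_mul_mul_comm]
  refine (mul_le_mul_of_nonneg_left hle' (by positivity)).trans_eq ?_
  rw [mul_pow, ← Real.exp_nat_mul, ← Real.exp_nat_mul, ← Real.exp_nat_mul, ← Real.exp_add]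
  congr 2
  · push_cast
    ring
  · push_cast
    rw [mul_div_cancel₀ _ two_ne_zero]
    ring
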